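/- Assume the standing setup, let W be the total number of U-rich lines, and define f(T) := (p - r/2 - 1/2)·T² - (n - 1)·(p - r/2 - 1/2)·T - p·(p - r)·T - N·T for T ∈ ℚ. Then f(W) ≤ f(n + 1). -/

import Mathlib

open Finset Polynomial

attribute [local instance] Classical.propDecidable

/-- The line in `(ZMod p)²` with slope `m` (where `none` denotes the vertical
slope `∞`) and "intercept" `c`. -/
noncomputable def lineWithSlope (p : ℕ) [NeZero p] (m : Option (ZMod p)) (c : ZMod p) :
    Finset (ZMod p × ZMod p) :=
  match m with
  | some m => Finset.univ.filter fun q => q.2 = m * q.1 + c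
  | none => Finset.univ.filter fun q => q.1 = c

/-- `ℓ` is `U`-rich: it meets `U` in at least `#U/p + 1` points. -/
def IsRich (p : ℕ) (U ℓ : Finset (ZMod p × ZMod p)) : Prop :=
  (U.card : ℚ) / p + 1 ≤ ((ℓ ∩ U).card : ℚ)

/-- `ℓ` is `U`-poor: it meets `U` in at most `#U/p - 1` points. -/
def IsPoor (p : ℕ) (U ℓ : Finset (ZMod p × ZMod p)) : Prop :=
  ((ℓ ∩ U).card : ℚ) ≤ (U.card : ℚ) / p - 1

/-- `m` is a `U`-rich direction: some line with slope `m` is `U`-rich. -/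
def IsRichDir (p : ℕ) [NeZero p] (U : Finset (ZMod p × ZMod p))
    (m : Option (ZMod p)) : Prop :=
  ∃ c : ZMod p, IsRich p U (lineWithSlope p m c)

/-- `m` is a `U`-special direction: some line with slope `m` is `U`-rich or `U`-poor. -/
def IsSpecialDir (p : ℕ) [NeZero p] (U : Finset (ZMod p × ZMod p))
    (m : Option (ZMod p)) : Prop :=
  ∃ c : ZMod p, IsRich p U (lineWithSlope p m c) ∨ IsPoor p U (lineWithSlope p m c)

/-- The set of `U`-rich lines, identified with pairs (slope, intercept). -/
noncomputable def richLines (p : ℕ) [NeZero p] (U : Finset (ZMod p × ZMod p)) :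
    Finset (Option (ZMod p) × ZMod p) :=
  Finset.univ.filter fun q => IsRich p U (lineWithSlope p q.1 q.2)

/-- The set of `U`-rich directions, as a finset. -/
noncomputable def richDirs (p : ℕ) [NeZero p] (U : Finset (ZMod p × ZMod p)) :
    Finset (Option (ZMod p)) :=
  Finset.univ.filter fun m => IsRichDir p U m

/-- `w_m`: the number of `U`-rich lines with slope `m`. -/
noncomputable def wSlope (p : ℕ) [NeZero p] (U : Finset (ZMod p × ZMod p))
    (m : Option (ZMod p)) : ℕ :=
  (Finset.univ.filter fun c : ZMod p => IsRich p U (lineWithSlope p m c)).card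


theorem coeff_eq_zero_of_coeff_derivative_eq_zero {p : ℕ} [Fact p.Prime] {g : (ZMod p)[X]} {m : ℕ}
    (hg : g.degree < (p : ℕ)) (h : ∀ k, m ≤ k → (derivative g).coeff k = 0) :
    ∀ k, m < k → g.coeff k = 0 := by
  intro k hk
  obtain ⟨l, rfl⟩ : ∃ l, k = l + 1 := ⟨k - 1, by omega⟩
  rcases le_or_gt p (l + 1) with hl | hl
  · exact coeff_eq_zero_of_degree_lt (lt_of_lt_of_le hg (by exact_mod_cast hl))
  · have h1 := h l (by omega)
    rw [coeff_derivative] at h1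
    refine (mul_eq_zero.mp h1).resolve_right fun h2 => ?_
    have h3 : ((l + 1 : ℕ) : ZMod p) = 0 := by exact_mod_cast h2
    rw [ZMod.natCast_eq_zero_iff] at h3
    exact absurd (Nat.le_of_dvd (by omega) h3) (by omega)

theorem derivative_X_pow_char_mul {p : ℕ} (A : (ZMod p)[X]) :
    derivative (X ^ p * A) = X ^ p * derivative A := by
  simp [derivative_mul, derivative_X_pow]

/-- If a monic polynomial `F = X ^ (p * n) + (terms of degree ≤ p * n - p + e)` satisfies
`(X ^ p - X) * F' = ψ * F` and `(n + 1) * e ≤ p`, then `ψ` is constant. -/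
theorem natDegree_eq_zero_of_X_pow_sub_X_mul_derivative {p n e : ℕ} [Fact p.Prime] (hn : 1 ≤ n)
    (he : 1 ≤ e) (hne : (n + 1) * e ≤ p) {F ψ : (ZMod p)[X]} (hF : F.Monic)
    (hdeg : F.natDegree = p * n)
    (hgap : ∀ k, p * n + e < k + p → k ≠ p * n → F.coeff k = 0)
    (hψ : (X ^ p - X) * derivative F = ψ * F) : ψ.natDegree = 0 := by
  have hp : 2 ≤ p := (Fact.out : p.Prime).two_le
  have hpn : p ≤ p * n := Nat.le_mul_of_pos_right _ hn
  have hep : e ≤ p := le_trans (Nat.le_mul_of_pos_left _ (by omega)) hne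
  have hder : (derivative F).natDegree ≤ p * n - p + e - 1 := by
    rw [natDegree_le_iff_coeff_eq_zero]
    intro k hk
    rw [coeff_derivative]
    by_cases hk' : k + 1 = p * n
    · have : ((k : ZMod p) + 1) = 0 := by
        have : ((k + 1 : ℕ) : ZMod p) = 0 := by rw [hk']; simp
        exact_mod_cast this
      rw [this, mul_zero]
    · rw [hgap (k + 1) (by omega) hk', zero_mul]
  have hψe : ψ.natDegree + 1 ≤ e := by
    by_cases hψ0 : ψ = 0
    · simp [hψ0, he]
    have h1 : ((X ^ p - X) * derivative F).natDegree = ψ.natDegree + p * n := by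
      rw [hψ, natDegree_mul hψ0 hF.ne_zero, hdeg]
    have h2 : ((X ^ p - X) * derivative F).natDegree ≤ p + (p * n - p + e - 1) :=
      natDegree_mul_le_of_le
        ((natDegree_sub_le_of_le (natDegree_X_pow_le p) natDegree_X_le).trans (by omega)) hder
    omega
  by_contra hne0
  have hψ1 : 1 ≤ ψ.natDegree := Nat.one_le_iff_ne_zero.mpr hne0
  have hψ0 : ψ ≠ 0 := by rintro rfl; simp at hψ1
  have hT : (X ^ p : (ZMod p)[X]).Monic := monic_X_pow p
  set q : ℕ → (ZMod p)[X] := fun i => (fun A => A /ₘ X ^ p)^[i] F with hq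
  have hq0 : q 0 = F := rfl
  have hqs : ∀ i, q (i + 1) = q i /ₘ X ^ p := fun i => Function.iterate_succ_apply' _ _ _
  have hsplit : ∀ i, q i = X ^ p * q (i + 1) + q i %ₘ X ^ p := fun i => by
    rw [hqs, add_comm, modByMonic_add_div]
  have hmod : ∀ i, (q i %ₘ X ^ p).degree < (p : ℕ) := fun i => by
    simpa using degree_modByMonic_lt (q i) hT
  have hqdeg : ∀ i, i ≤ n → (q i).Monic ∧ (q i).natDegree = p * (n - i) := by
    intro i
    induction i with
    | zero => intro _; exact ⟨hF, by simpa [hq0] using hdeg⟩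
    | succ i ih =>
      intro hi
      obtain ⟨h1, h2⟩ := ih (by omega)
      have h3 : p * (n - i) = p * (n - (i + 1)) + p := by
        rw [← Nat.mul_succ]; congr 1; omega
      refine ⟨?_, ?_⟩
      · rw [hqs, Monic, leadingCoeff_divByMonic_of_monic hT]
        · exact h1
        · rw [degree_X_pow, degree_eq_natDegree h1.ne_zero, h2]
          exact_mod_cast (by omega)
      · rw [hqs, natDegree_divByMonic _ hT, h2, natDegree_X_pow]; omega
  have hqn : q n = 1 := by
    obtain ⟨h1, h2⟩ := hqdeg n le_rfl
    exact h1.natDegree_eq_zero.mp (by simpa using h2)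
  set E : (ZMod p)[X] → (ZMod p)[X] := fun A => (X ^ p - X) * derivative A - ψ * A with hE
  set V : (ZMod p)[X] → (ZMod p)[X] := fun g => X * derivative g + ψ * g with hV
  have hEV : ∀ i, E (q i) = X ^ p * (E (q (i + 1)) + derivative (q i %ₘ X ^ p))
      - V (q i %ₘ X ^ p) := by
    intro i
    have h1 : E (q i) = E (X ^ p * q (i + 1) + q i %ₘ X ^ p) := by rw [← hsplit]
    rw [h1]
    simp only [hE, hV, derivative_add, derivative_X_pow_char_mul]
    ring
  have hdg : ∀ i k, p - 1 ≤ k → (derivative (q i %ₘ X ^ p)).coeff k = 0 := by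
    intro i k hk
    rw [coeff_derivative, coeff_eq_zero_of_degree_lt, zero_mul]
    exact lt_of_lt_of_le (hmod i) (by exact_mod_cast (by omega))
  have hVdeg : ∀ i k, p + e - 1 ≤ k → (V (q i %ₘ X ^ p)).coeff k = 0 := by
    intro i k hk
    have h1 : (q i %ₘ X ^ p).natDegree ≤ p - 1 := by
      rw [natDegree_le_iff_coeff_eq_zero]
      intro N hN
      exact coeff_eq_zero_of_degree_lt (lt_of_lt_of_le (hmod i) (by exact_mod_cast (by omega)))
    have h2 : (V (q i %ₘ X ^ p)).natDegree ≤ p + e - 2 := by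
      refine natDegree_add_le_of_degree_le ?_ ?_
      · refine (natDegree_mul_le_of_le natDegree_X_le
          ((natDegree_derivative_le _).trans (Nat.sub_le_sub_right h1 1))).trans (by omega)
      · exact (natDegree_mul_le_of_le (le_refl _) h1).trans (by omega)
    exact coeff_eq_zero_of_natDegree_lt (by omega)
  have hlow : ∀ i, (∀ k, p - 1 ≤ k → (E (q i)).coeff k = 0) →
      ∀ k, e - 1 ≤ k → (E (q (i + 1)) + derivative (q i %ₘ X ^ p)).coeff k = 0 := by
    intro i hi k hk
    have h1 := hEV i
    have h2 : X ^ p * (E (q (i + 1)) + derivative (q i %ₘ X ^ p))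
        = E (q i) + V (q i %ₘ X ^ p) := by rw [h1]; ring
    rw [← coeff_X_pow_mul _ p k, h2, coeff_add, hi _ (by omega), hVdeg _ _ (by omega), add_zero]
  have hEdeg : ∀ i, ∀ k, p - 1 ≤ k → (E (q i)).coeff k = 0 := by
    intro i
    induction i with
    | zero => intro k _; simp only [hE, hq0, hψ, sub_self, coeff_zero]
    | succ i ih =>
      intro k hk
      have h1 := hlow i ih k (by omega)
      rwa [coeff_add, hdg i k hk, add_zero] at h1
  have hVne : ∀ {f : (ZMod p)[X]}, f ≠ 0 → V f ≠ 0 := by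
    intro f hf h0
    have h7 : ψ * f = -(X * derivative f) := by
      simp only [hV] at h0; linear_combination h0
    have h8 : (ψ * f).natDegree = ψ.natDegree + f.natDegree := natDegree_mul hψ0 hf
    have hd : derivative f ≠ 0 := fun hd => by
      rw [hd, mul_zero, neg_zero] at h7
      exact mul_ne_zero hψ0 hf h7
    have : f.natDegree ≠ 0 := fun h0 => hd (by
      rw [eq_C_of_natDegree_eq_zero h0, derivative_C])
    rw [h7, natDegree_neg, natDegree_mul X_ne_zero hd, natDegree_X] at h8
    have h5 := natDegree_derivative_le f
    omega
  have hmain : ∀ j, j ≤ n → (q (n - j) %ₘ X ^ p).natDegree ≤ j * e ∧ q (n - j) %ₘ X ^ p ≠ 0 ∧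
      E (q (n - j)) = -V (q (n - j) %ₘ X ^ p) := by
    intro j
    induction j with
    | zero =>
      intro _
      have h1 : (1 : (ZMod p)[X]) %ₘ X ^ p = 1 := by
        rw [modByMonic_eq_self_iff hT, degree_one, degree_X_pow]
        exact_mod_cast (by omega)
      simp [hqn, h1, hE, hV]
    | succ j ih =>
      intro hj
      obtain ⟨h1, h2, h3⟩ := ih (by omega)
      obtain ⟨i, hi⟩ : ∃ i, n - (j + 1) = i := ⟨_, rfl⟩
      have hi' : n - j = i + 1 := by omega
      rw [hi] at *
      rw [hi'] at h1 h2 h3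
      set g₀ := q (i + 1) %ₘ X ^ p with hg₀
      set g := q i %ₘ X ^ p with hg
      have hVle : ∀ {f : (ZMod p)[X]} {m : ℕ}, f.natDegree ≤ m → (V f).natDegree ≤ m + e - 1 := by
        intro f m hf
        refine natDegree_add_le_of_degree_le ?_ ?_
        · by_cases hd : derivative f = 0
          · simp [hd]
          have : f.natDegree ≠ 0 := fun h0 => hd (by
            rw [eq_C_of_natDegree_eq_zero h0, derivative_C])
          have h5 := natDegree_derivative_le f
          have h6 : (X * derivative f).natDegree ≤ 1 + (f.natDegree - 1) :=
            natDegree_mul_le_of_le natDegree_X_le h5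
          omega
        · exact (natDegree_mul_le_of_le (le_refl _) hf).trans (by omega)
      have hje : (j + 1) * e = j * e + e := by ring
      have hjp : (j + 1) * e + e ≤ p := by
        calc (j + 1) * e + e = (j + 2) * e := by ring
          _ ≤ (n + 1) * e := Nat.mul_le_mul_right _ (by omega)
          _ ≤ p := hne
      have hgdeg : g.natDegree ≤ (j + 1) * e := by
        rw [natDegree_le_iff_coeff_eq_zero]
        refine coeff_eq_zero_of_coeff_derivative_eq_zero (hmod i) fun k hk => ?_
        have h4 := hlow i (hEdeg i) k (by omega)
        rw [h3, coeff_add, coeff_neg, coeff_eq_zero_of_natDegree_lt (p := V g₀), neg_zero,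
          zero_add] at h4
        · exact h4
        · exact lt_of_le_of_lt (hVle h1) (by omega)
      have hzero : E (q (i + 1)) + derivative g = 0 := by
        ext k
        have h4 := hEV i
        have h5 : X ^ p * (E (q (i + 1)) + derivative g) = E (q i) + V g := by rw [h4]; ring
        rw [← coeff_X_pow_mul _ p k, h5, coeff_add, hEdeg i _ (by omega), zero_add, coeff_zero]
        exact coeff_eq_zero_of_natDegree_lt (lt_of_le_of_lt (hVle hgdeg) (by omega))
      refine ⟨hgdeg, fun hg0 => ?_, ?_⟩
      · rw [hg0, derivative_zero, add_zero, h3, neg_eq_zero] at hzero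
        exact hVne h2 hzero
      · rw [hEV i, hzero, mul_zero, zero_sub]
  obtain ⟨-, h2, h3⟩ := hmain n le_rfl
  rw [Nat.sub_self] at h2 h3
  refine hVne h2 (neg_eq_zero.mp ?_)
  rw [← h3]
  simp only [hE, hq0, hψ, sub_self]

theorem natCast_rootMultiplicity_eq_neg {p : ℕ} [Fact p.Prime] {F : (ZMod p)[X]} (hF : F ≠ 0)
    {s : ZMod p} (hs : (X ^ p - X) * derivative F = C s * F) (c : ZMod p) :
    ((F.rootMultiplicity c : ℕ) : ZMod p) = -s := by
  obtain ⟨q, hq, hqc⟩ := exists_eq_pow_rootMultiplicity_mul_and_not_dvd F hF c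
  set k := F.rootMultiplicity c
  rw [dvd_iff_isRoot, IsRoot.def] at hqc
  have hp : p - 1 + 1 = p := Nat.sub_add_cancel (Fact.out : p.Prime).one_le
  have hX : (X ^ p - X : (ZMod p)[X]) = (X - C c) * ((X - C c) ^ (p - 1) - 1) := by
    have h1 : (X - C c) ^ p = (X ^ p - C c : (ZMod p)[X]) := by
      rw [sub_pow_char, ← C_pow, ZMod.pow_card]
    rw [mul_sub, ← pow_succ', hp, h1]; ring
  have hd : (X - C c) * derivative ((X - C c) ^ k) = C (k : ZMod p) * (X - C c) ^ k := by
    rcases Nat.eq_zero_or_pos k with h0 | h0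
    · simp [h0]
    · obtain ⟨l, hl⟩ : ∃ l, k = l + 1 := ⟨k - 1, by omega⟩
      rw [hl, derivative_X_sub_C_pow, Nat.add_sub_cancel]
      simp only [C_eq_natCast]
      ring
  have h2 : (X - C c) ^ k * (((X - C c) ^ (p - 1) - 1) *
      (C (k : ZMod p) * q + (X - C c) * derivative q)) = (X - C c) ^ k * (C s * q) := by
    rw [hX, hq, derivative_mul] at hs
    linear_combination hs - ((X - C c) ^ (p - 1) - 1) * q * hd
  have h3 := congrArg (eval c) (mul_left_cancel₀ (pow_ne_zero k (X_sub_C_ne_zero c)) h2)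
  have hp1 : p - 1 ≠ 0 := by have := (Fact.out : p.Prime).two_le; omega
  simp only [eval_mul, eval_sub, eval_pow, eval_X, eval_C, sub_self, eval_add, eval_one,
    zero_pow hp1, zero_mul, add_zero] at h3
  refine mul_right_cancel₀ hqc ?_
  linear_combination -h3

theorem card_le_of_lt_rootMultiplicity {p n : ℕ} [Fact p.Prime] {F : (ZMod p)[X]} (hF : F.Monic)
    (hdeg : F.natDegree = p * n) {s : ZMod p} (hs : (X ^ p - X) * derivative F = C s * F)
    (R : Finset (ZMod p)) (hR : ∀ c ∈ R, n + 1 ≤ F.rootMultiplicity c) : R.card ≤ n := by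
  have hp : 0 < p := (Fact.out : p.Prime).pos
  have hsum : ∑ c : ZMod p, F.rootMultiplicity c ≤ p * n := by
    rw [← hdeg]
    refine le_trans (le_of_eq ?_) (card_roots' F)
    rw [← Multiset.sum_count_eq_card (s := Finset.univ) (fun _ _ => Finset.mem_univ _)]
    exact Finset.sum_congr rfl fun c _ => (count_roots F).symm
  have hmod : ∀ c, F.rootMultiplicity c % p = (-s).val := fun c => by
    rw [← natCast_rootMultiplicity_eq_neg hF.ne_zero hs c, ZMod.val_natCast]
  have ht : (-s).val ≤ n := by
    refine Nat.le_of_mul_le_mul_left (le_trans ?_ hsum) hp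
    calc p * (-s).val = ∑ _c : ZMod p, (-s).val := by simp [ZMod.card]
      _ ≤ _ := Finset.sum_le_sum fun c _ => by rw [← hmod c]; exact Nat.mod_le _ _
  have hbig : ∀ c ∈ R, p ≤ F.rootMultiplicity c := fun c hc => by
    by_contra! h
    have h1 := hmod c
    rw [Nat.mod_eq_of_lt h] at h1
    have := hR c hc
    omega
  refine Nat.le_of_mul_le_mul_left (le_trans ?_ hsum) hp
  calc p * R.card = ∑ _c ∈ R, p := by simp [mul_comm]
    _ ≤ ∑ c ∈ R, F.rootMultiplicity c := Finset.sum_le_sum hbig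
    _ ≤ _ := Finset.sum_le_sum_of_subset (Finset.subset_univ R)

/-- `P ∈ R[y][x]` has total degree at most `d`. -/
def HasTotalDegreeLE {R : Type*} [Semiring R] (P : R[X][X]) (d : ℕ) : Prop :=
  ∀ i j, d < i + j → (P.coeff i).coeff j = 0

namespace HasTotalDegreeLE

variable {R : Type*} [CommRing R] {P Q : R[X][X]} {d d' : ℕ}

theorem mono (hP : HasTotalDegreeLE P d) (h : d ≤ d') : HasTotalDegreeLE P d' :=
  fun i j hij => hP i j (by omega)

theorem add (hP : HasTotalDegreeLE P d) (hQ : HasTotalDegreeLE Q d) :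
    HasTotalDegreeLE (P + Q) d := fun i j hij => by
  rw [coeff_add, coeff_add, hP i j hij, hQ i j hij, add_zero]

theorem sub (hP : HasTotalDegreeLE P d) (hQ : HasTotalDegreeLE Q d) :
    HasTotalDegreeLE (P - Q) d := fun i j hij => by
  rw [coeff_sub, coeff_sub, hP i j hij, hQ i j hij, sub_zero]

theorem mul (hP : HasTotalDegreeLE P d) (hQ : HasTotalDegreeLE Q d') :
    HasTotalDegreeLE (P * Q) (d + d') := fun i j hij => by
  rw [coeff_mul, finsetSum_coeff]
  refine Finset.sum_eq_zero fun a ha => ?_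
  rw [coeff_mul]
  refine Finset.sum_eq_zero fun b hb => ?_
  rw [Finset.HasAntidiagonal.mem_antidiagonal] at ha hb
  rcases lt_or_ge d (a.1 + b.1) with h | h
  · rw [hP _ _ h, zero_mul]
  · rw [hQ _ _ (by omega), mul_zero]

theorem natDegree_coeff_le (hP : HasTotalDegreeLE P d) (i : ℕ) : (P.coeff i).natDegree ≤ d :=
  natDegree_le_iff_coeff_eq_zero.mpr fun j hj => hP i j (by omega)

theorem derivative (hP : HasTotalDegreeLE P (d + 1)) :
    HasTotalDegreeLE (Polynomial.derivative P) d := fun i j hij => by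
  rw [coeff_derivative]
  have h : ((i : R[X]) + 1) = C ((i : R) + 1) := by simp
  rw [h, coeff_mul_C, hP _ _ (by omega), zero_mul]

theorem monomial {a : R[X]} {k : ℕ} (h : ∀ j, d < k + j → a.coeff j = 0) :
    HasTotalDegreeLE (Polynomial.monomial k a) d := fun i j hij => by
  rw [coeff_monomial]
  split_ifs with hk
  · exact h j (by omega)
  · simp

theorem C {a : R[X]} (h : a.natDegree ≤ d) : HasTotalDegreeLE (Polynomial.C a) d := by
  rw [← monomial_zero_left]
  exact monomial fun j hj => coeff_eq_zero_of_natDegree_lt (by omega)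

theorem modByMonic {G : R[X][X]} {r : ℕ} (hG : G.Monic) (hr : G.natDegree = r)
    (hGr : HasTotalDegreeLE G r) (hP : HasTotalDegreeLE P d) : HasTotalDegreeLE (P %ₘ G) d := by
  rcases subsingleton_or_nontrivial R with hR | hR
  · exact fun i j _ => Subsingleton.elim _ _
  obtain ⟨k, hk⟩ : ∃ k, P.natDegree < k := ⟨_, Nat.lt_succ_self _⟩
  induction k generalizing P with
  | zero => omega
  | succ k ih =>
    by_cases hP0 : P = 0
    · simpa [hP0] using hP
    by_cases hlt : P.degree < G.degree
    · rwa [(modByMonic_eq_self_iff hG).mpr hlt]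
    have hle : r ≤ P.natDegree := by
      rw [not_lt, degree_eq_natDegree hP0, degree_eq_natDegree hG.ne_zero, hr] at hlt
      exact_mod_cast hlt
    have hlc : P.leadingCoeff ≠ 0 := leadingCoeff_ne_zero.mpr hP0
    have hd : P.natDegree ≤ d := by
      by_contra! h
      refine leadingCoeff_ne_zero.mpr hlc (hP _ _ ?_)
      omega
    have hmul : HasTotalDegreeLE
        (Polynomial.monomial (P.natDegree - r) P.leadingCoeff * G) d := by
      refine (mul (d := d - r) (monomial fun j hj => hP _ _ ?_) hGr).mono (by omega)
      omega
    have hmod : (P - Polynomial.monomial (P.natDegree - r) P.leadingCoeff * G) %ₘ G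
        = P %ₘ G := by
      rw [sub_modByMonic, (modByMonic_eq_zero_iff_dvd hG).mpr (dvd_mul_left _ _), sub_zero]
    rw [← hmod]
    set P' := P - Polynomial.monomial (P.natDegree - r) P.leadingCoeff * G with hP'
    by_cases hP'0 : P' = 0
    · rw [hP'0, zero_modByMonic]; intro i j _; simp
    refine ih (hP.sub hmul) ?_
    have h1 : (Polynomial.monomial (P.natDegree - r) P.leadingCoeff * G).degree = P.degree := by
      rw [hG.degree_mul, degree_monomial _ hlc, degree_eq_natDegree hG.ne_zero, hr,
        degree_eq_natDegree hP0, ← Nat.cast_add, Nat.sub_add_cancel hle]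
    have h2 := degree_sub_lt_left h1.symm hP0 (by
      rw [leadingCoeff_mul_monic hG, leadingCoeff_monomial])
    have h3 := natDegree_lt_natDegree hP'0 h2
    omega

end HasTotalDegreeLE

/-- A polynomial of total degree `< #Y` that is divisible by the monic `G` on each of the lines
`y = m`, `m ∈ Y`, is divisible by `G`. -/
theorem dvd_of_forall_map_evalRingHom_dvd {K : Type*} [Field K] {G P : K[X][X]} {r d : ℕ}
    (hG : G.Monic) (hr : G.natDegree = r) (hGr : HasTotalDegreeLE G r)
    (hP : HasTotalDegreeLE P d) (Y : Finset K) (hY : d < Y.card)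
    (h : ∀ m ∈ Y, G.map (evalRingHom m) ∣ P.map (evalRingHom m)) : G ∣ P := by
  rw [← modByMonic_eq_zero_iff_dvd hG]
  ext1 i
  refine eq_zero_of_natDegree_lt_card_of_eval_eq_zero' _ Y (fun m hm => ?_)
    (lt_of_le_of_lt ((HasTotalDegreeLE.modByMonic hG hr hGr hP).natDegree_coeff_le i) hY)
  rw [← coe_evalRingHom, ← coeff_map, map_modByMonic _ hG,
    (modByMonic_eq_zero_iff_dvd (hG.map _)).mpr (h m hm), coeff_zero]

/-- The derivative of `P ∈ R[y][x]` with respect to `y`. -/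
noncomputable def innerDerivative {R : Type*} [CommRing R] (P : R[X][X]) : R[X][X] :=
  Bivariate.swap (derivative (Bivariate.swap P))

section innerDerivative

variable {R : Type*} [CommRing R]

theorem innerDerivative_add (P Q : R[X][X]) :
    innerDerivative (P + Q) = innerDerivative P + innerDerivative Q := by
  simp only [innerDerivative, map_add]

theorem innerDerivative_mul (P Q : R[X][X]) :
    innerDerivative (P * Q) = innerDerivative P * Q + P * innerDerivative Q := by
  simp only [innerDerivative, map_mul, derivative_mul, map_add, Bivariate.swap_swap_apply]

theorem coeff_innerDerivative (P : R[X][X]) (i : ℕ) :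
    (innerDerivative P).coeff i = derivative (P.coeff i) := by
  induction P using Polynomial.induction_on' with
  | add P Q hP hQ => rw [innerDerivative_add, coeff_add, hP, hQ, coeff_add, derivative_add]
  | monomial n a =>
    induction a using Polynomial.induction_on' with
    | add a b ha hb =>
      rw [map_add, innerDerivative_add, coeff_add, ha, hb, coeff_add, derivative_add]
    | monomial m c =>
      rw [innerDerivative, Bivariate.swap_monomial_monomial, derivative_monomial]
      have h : (monomial n c * (m : R[X])) = monomial n (c * m) := by
        rw [← C_eq_natCast, monomial_mul_C]
      rw [h, Bivariate.swap_monomial_monomial, coeff_monomial, coeff_monomial]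
      split_ifs
      · rw [derivative_monomial]
      · rw [derivative_zero]

theorem innerDerivative_C (a : R[X]) : innerDerivative (C a) = C (derivative a) := by
  ext1 i
  rw [coeff_innerDerivative, coeff_C, coeff_C]
  split_ifs <;> simp

theorem HasTotalDegreeLE.innerDerivative {P : R[X][X]} {d : ℕ}
    (hP : HasTotalDegreeLE P (d + 1)) : HasTotalDegreeLE (innerDerivative P) d :=
  fun i j hij => by
    rw [coeff_innerDerivative, coeff_derivative, hP _ _ (by omega), zero_mul]

end innerDerivative

theorem prod_X_sub_C_zmod (p : ℕ) [Fact p.Prime] :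
    ∏ c : ZMod p, (X - C c) = (X ^ p - X : (ZMod p)[X]) := by
  have h := FiniteField.roots_X_pow_card_sub_X (ZMod p)
  rw [ZMod.card] at h
  have hd := FiniteField.X_pow_card_sub_X_natDegree_eq (ZMod p) (Fact.out : p.Prime).one_lt
  have hm : (X ^ p - X : (ZMod p)[X]).Monic :=
    monic_X_pow_sub (by rw [degree_X]; exact_mod_cast (Fact.out : p.Prime).one_lt)
  have h2 := prod_multiset_X_sub_C_of_monic_of_roots_card_eq hm (by
    rw [h, hd, Finset.card_val, Finset.card_univ, ZMod.card])
  rw [h] at h2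
  exact h2

theorem dvd_of_dvd_C_mul {R : Type*} [CommRing R] [IsDomain R] {G P : R[X]} (hG : G.Monic) {a : R}
    (ha : a ≠ 0) (h : G ∣ C a * P) : G ∣ P := by
  rw [← modByMonic_eq_zero_iff_dvd hG] at h ⊢
  rw [← smul_eq_C_mul, smul_modByMonic] at h
  exact (smul_eq_zero.mp h).resolve_left ha

/-- A plane curve `G(x, y) = 0` of degree `r`, all of whose points on many vertical lines `y = m`
are simple and rational, is tangent to the field `(x ^ p - x, y ^ p - y)`. In particular its
restriction to every rational line `y = m` satisfies `G(x, m) ∣ (x ^ p - x) * ∂ₓ G(x, m)`. -/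
theorem map_evalRingHom_dvd_X_pow_sub_X_mul_derivative {p r e : ℕ} [Fact p.Prime]
    {G : (ZMod p)[X][X]} (hG : G.Monic) (hr : G.natDegree = r) (hGr : HasTotalDegreeLE G r)
    (Y : Finset (ZMod p)) (hY : Y.card + e = p) (he : 2 * e + r ≤ p)
    (hdvd : ∀ m ∈ Y, G.map (evalRingHom m) ∣ X ^ p - X) (y : ZMod p) :
    G.map (evalRingHom y) ∣ (X ^ p - X) * derivative (G.map (evalRingHom y)) := by
  rcases Nat.eq_zero_or_pos r with hr0 | hr0
  · have h1 : G = 1 := hG.natDegree_eq_zero.mp (hr.trans hr0)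
    simp [h1]
  obtain ⟨r', rfl⟩ : ∃ r', r = r' + 1 := ⟨r - 1, by omega⟩
  set M : (ZMod p)[X] := ∏ m ∈ Y, (X - C m) with hM
  set L : (ZMod p)[X] := ∏ m ∈ Yᶜ, (X - C m) with hL
  have hMm : M.Monic := monic_prod_of_monic _ _ fun m _ => monic_X_sub_C m
  have hLm : L.Monic := monic_prod_of_monic _ _ fun m _ => monic_X_sub_C m
  have hMdeg : M.natDegree = Y.card := natDegree_finsetProd_X_sub_C_eq_card _ _
  have hLdeg : L.natDegree = e := by
    rw [hL, natDegree_finsetProd_X_sub_C_eq_card, Finset.card_compl, ZMod.card]; omega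
  have hML : M * L = X ^ p - X := by
    rw [hM, hL, Finset.prod_mul_prod_compl, prod_X_sub_C_zmod]
  set P : (ZMod p)[X][X] := X ^ p - X with hP
  have hPdeg : HasTotalDegreeLE P p := by
    refine HasTotalDegreeLE.sub ?_ ?_
    · rw [← monomial_one_right_eq_X_pow]
      refine HasTotalDegreeLE.monomial fun j hj => ?_
      rw [coeff_one, if_neg (by omega)]
    · rw [← monomial_one_one_eq_X]
      refine HasTotalDegreeLE.monomial fun j hj => ?_
      have := (Fact.out : p.Prime).one_le
      rw [coeff_one, if_neg (by omega)]
  have hrem := HasTotalDegreeLE.modByMonic hG hr hGr hPdeg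
  have hMrem : C M ∣ P %ₘ G := by
    rw [C_dvd_iff_dvd_coeff]
    intro i
    refine Finset.prod_dvd_of_coprime
      ((pairwise_coprime_X_sub_C Function.injective_id).set_pairwise _) fun m hm => ?_
    rw [dvd_iff_isRoot, IsRoot.def, ← coe_evalRingHom, ← coeff_map, map_modByMonic _ hG,
      (modByMonic_eq_zero_iff_dvd (hG.map _)).mpr, coeff_zero]
    simpa [hP] using hdvd m hm
  obtain ⟨S, hS⟩ := hMrem
  have hSdeg : HasTotalDegreeLE S e := by
    intro i j hij
    by_contra hne
    have hSi : S.coeff i ≠ 0 := fun h => hne (by rw [h, coeff_zero])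
    have h1 := le_natDegree_of_ne_zero hne
    have h2 : (P %ₘ G).coeff i = M * S.coeff i := by rw [hS, coeff_C_mul]
    have h3 : ((P %ₘ G).coeff i).natDegree = Y.card + (S.coeff i).natDegree := by
      rw [h2, natDegree_mul hMm.ne_zero hSi, hMdeg]
    have h4 := hrem i ((P %ₘ G).coeff i).natDegree (by omega)
    rw [coeff_natDegree, leadingCoeff_eq_zero, h2] at h4
    exact mul_ne_zero hMm.ne_zero hSi h4
  set Q := P /ₘ G with hQ
  have hdiv : P = C M * S + G * Q := by rw [← hS, hQ, modByMonic_add_div]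
  set W := C L * innerDerivative G + S * derivative G with hW
  have hWdeg : HasTotalDegreeLE W (e + r') :=
    ((HasTotalDegreeLE.C hLdeg.le).mul hGr.innerDerivative).add (hSdeg.mul hGr.derivative)
  have hWdvd : G ∣ W := by
    refine dvd_of_forall_map_evalRingHom_dvd hG hr hGr hWdeg Y (by omega) fun m hm => ?_
    have hMm0 : evalRingHom m M = 0 := by
      rw [coe_evalRingHom, hM, eval_prod, Finset.prod_eq_zero hm]; simp
    have hx := congrArg (fun A => (derivative A).map (evalRingHom m)) hdiv
    have hy := congrArg (fun A => (innerDerivative A).map (evalRingHom m)) hdiv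
    have hP0 : innerDerivative P = 0 := by
      ext1 i
      rw [coeff_innerDerivative, hP, coeff_sub, coeff_X_pow, coeff_X, coeff_zero]
      split_ifs <;> simp
    have hP1 : derivative P = -1 := by simp [hP, derivative_X_pow]
    have hMLm : evalRingHom m (derivative M) * evalRingHom m L = -1 := by
      have := congrArg (fun A => evalRingHom m (derivative A)) hML
      simp only [derivative_mul, map_add, map_mul, hMm0, zero_mul, add_zero] at this
      rw [this]; simp [derivative_X_pow]
    simp only [hP1, hP0, derivative_add, derivative_mul, innerDerivative_add, innerDerivative_mul,
      innerDerivative_C, derivative_C, Polynomial.map_add, Polynomial.map_mul, map_C, hMm0,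
      Polynomial.map_neg, Polynomial.map_one, Polynomial.map_zero, C_0, zero_mul, zero_add,
      add_zero] at hx hy
    simp only [hW, Polynomial.map_add, Polynomial.map_mul, map_C]
    have hMLm' := congrArg (C : ZMod p → (ZMod p)[X]) hMLm
    rw [C_mul, C_neg, C_1] at hMLm'
    generalize G.map (evalRingHom m) = g at *
    generalize (innerDerivative G).map (evalRingHom m) = gy at *
    generalize (derivative G).map (evalRingHom m) = gx at *
    generalize S.map (evalRingHom m) = s at *
    generalize Q.map (evalRingHom m) = q at *
    generalize (derivative Q).map (evalRingHom m) = qx at *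
    generalize (innerDerivative Q).map (evalRingHom m) = qy at *
    generalize C (evalRingHom m L) = l at *
    generalize C (evalRingHom m (derivative M)) = m' at *
    exact ⟨gx * (l * qy + s * qx) - qx * (l * gy + s * gx), by
      linear_combination (-(l * gy + s * gx) + gx * s) * hx + gx * l * hy + gx * s * hMLm'⟩
  have hfinal : G ∣ (C (X ^ p - X) * innerDerivative G + P * derivative G) := by
    refine dvd_of_dvd_C_mul hG hLm.ne_zero ?_
    have h1 : C L * (C (X ^ p - X) * innerDerivative G + P * derivative G)
        = C (X ^ p - X) * W + G * (C L * Q * derivative G) := by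
      rw [hdiv, hW, ← hML, C_mul]; ring
    rw [h1]
    exact dvd_add (hWdvd.mul_left _) (dvd_mul_right _ _)
  have h2 := map_dvd (evalRingHom y) hfinal
  have h3 : evalRingHom y (X ^ p - X : (ZMod p)[X]) = 0 := by
    simp [ZMod.pow_card]
  rw [Polynomial.map_add, Polynomial.map_mul, map_C, h3, C_0, zero_mul, zero_add,
    Polynomial.map_mul, ← derivative_map] at h2
  simpa [hP] using h2

section ReciprocalPolynomials

theorem natDegree_prod_one_sub_C_mul_X_le {ι R : Type*} [CommRing R] (s : Finset ι) (a : ι → R) :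
    (∏ u ∈ s, (1 - C (a u) * X)).natDegree ≤ s.card := by
  refine (natDegree_prod_le _ _).trans ?_
  rw [Finset.card_eq_sum_ones]
  refine Finset.sum_le_sum fun u _ => ?_
  compute_degree

theorem reflect_prod_one_sub_C_mul_X {ι R : Type*} [CommRing R] (s : Finset ι) (a : ι → R) :
    reflect s.card (∏ u ∈ s, (1 - C (a u) * X)) = ∏ u ∈ s, (X - C (a u)) := by
  induction s using Finset.induction_on with
  | empty => simp
  | insert u s hu ih =>
    rw [Finset.prod_insert hu, Finset.prod_insert hu, Finset.card_insert_of_notMem hu, add_comm,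
      reflect_mul _ _ (by compute_degree) (natDegree_prod_one_sub_C_mul_X_le s a), ih]
    congr 1
    rw [reflect_sub, reflect_one, reflect_C_mul]
    have : reflect 1 (X : R[X]) = 1 := by
      simp
    rw [this]; simp

theorem prod_one_sub_C_mul_X_zmod (p : ℕ) [Fact p.Prime] :
    ∏ c : ZMod p, (1 - C c * X) = (1 - X ^ (p - 1) : (ZMod p)[X]) := by
  have h := reflect_prod_one_sub_C_mul_X (Finset.univ : Finset (ZMod p)) id
  have hp := (Fact.out : p.Prime).one_le
  simp only [id] at h
  rw [prod_X_sub_C_zmod, Finset.card_univ, ZMod.card] at h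
  have h2 := congrArg (reflect p) h
  rw [reflect_reflect, reflect_sub] at h2
  rw [h2, ← monomial_one_right_eq_X_pow, ← monomial_one_right_eq_X_pow]
  have h3 : (X : (ZMod p)[X]) = X ^ 1 := (pow_one X).symm
  rw [monomial_one_right_eq_X_pow, reflect_monomial, h3, reflect_monomial, revAt_le le_rfl,
    revAt_le hp]
  simp [monomial_one_right_eq_X_pow]

end ReciprocalPolynomials

/-- The power series `∏ 1 / (1 - a u * X)`. -/
noncomputable def invProdSeries {ι R : Type*} [CommRing R] (s : Finset ι) (a : ι → R) :
    PowerSeries R :=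
  ∏ u ∈ s, PowerSeries.mk fun j => a u ^ j

theorem prod_one_sub_C_mul_X_mul_invProdSeries {ι R : Type*} [CommRing R] (s : Finset ι)
    (a : ι → R) :
    ((∏ u ∈ s, (1 - C (a u) * X) : R[X]) : PowerSeries R) * invProdSeries s a = 1 := by
  rw [← coeToPowerSeries.ringHom_apply, map_prod, invProdSeries, ← Finset.prod_mul_distrib]
  refine Finset.prod_eq_one fun u _ => ?_
  ext j
  rw [coeToPowerSeries.ringHom_apply, Polynomial.coe_sub, Polynomial.coe_mul,
    Polynomial.coe_one, Polynomial.coe_C, Polynomial.coe_X, sub_mul, one_mul,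
    mul_assoc, map_sub, PowerSeries.coeff_C_mul]
  cases j with
  | zero => simp
  | succ j => simp [PowerSeries.coeff_succ_X_mul, PowerSeries.coeff_one, pow_succ']

theorem map_invProdSeries {ι R R' : Type*} [CommRing R] [CommRing R'] (f : R →+* R')
    (s : Finset ι) (a : ι → R) :
    PowerSeries.map f (invProdSeries s a) = invProdSeries s (fun u => f (a u)) := by
  rw [invProdSeries, invProdSeries, map_prod]
  refine Finset.prod_congr rfl fun u _ => ?_
  ext j
  simp

theorem natDegree_coeff_invProdSeries_le {ι R : Type*} [CommRing R] (s : Finset ι)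
    (a : ι → R[X]) (ha : ∀ u ∈ s, (a u).natDegree ≤ 1) (j : ℕ) :
    (PowerSeries.coeff j (invProdSeries s a)).natDegree ≤ j := by
  induction s using Finset.induction_on generalizing j with
  | empty =>
    rw [invProdSeries, Finset.prod_empty, PowerSeries.coeff_one]
    split_ifs <;> simp
  | insert u s hu ih =>
    rw [invProdSeries, Finset.prod_insert hu, PowerSeries.coeff_mul]
    refine natDegree_sum_le_of_forall_le _ _ fun x hx => ?_
    rw [Finset.HasAntidiagonal.mem_antidiagonal] at hx
    have h1 := ih (fun v hv => ha v (Finset.mem_insert_of_mem hv)) x.2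
    have h2 := natDegree_pow_le_of_le x.1 (ha u (Finset.mem_insert_self _ _))
    rw [PowerSeries.coeff_mk, ← hx]
    exact (natDegree_mul_le_of_le h2 h1).trans (by omega)

theorem constantCoeff_invProdSeries {ι R : Type*} [CommRing R] (s : Finset ι) (a : ι → R) :
    PowerSeries.coeff 0 (invProdSeries s a) = 1 := by
  rw [PowerSeries.coeff_zero_eq_constantCoeff_apply, invProdSeries, map_prod]
  refine Finset.prod_eq_one fun u _ => ?_
  rw [← PowerSeries.coeff_zero_eq_constantCoeff_apply]; simp

section Fibres

variable {ι : Type*} {p n r : ℕ} [Fact p.Prime] {U : Finset ι} {a : ι → ZMod p}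

theorem card_filter_card_fibre_add_one_eq (hcard : U.card + r = n * p)
    (ha : ∀ c, #{u ∈ U | a u = c} = n ∨ #{u ∈ U | a u = c} + 1 = n) :
    #{c | #{u ∈ U | a u = c} + 1 = n} = r := by
  have h1 : U.card = ∑ c, #{u ∈ U | a u = c} :=
    Finset.card_eq_sum_card_fiberwise fun _ _ => Finset.mem_coe.mpr (Finset.mem_univ _)
  have h2 : ∑ c, (#{u ∈ U | a u = c} + if #{u ∈ U | a u = c} + 1 = n then 1 else 0)
      = ∑ _c : ZMod p, n := by
    refine Finset.sum_congr rfl fun c _ => ?_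
    have := ha c
    split_ifs <;> omega
  rw [Finset.sum_add_distrib, ← h1, ← Finset.card_filter, Finset.sum_const, Finset.card_univ,
    ZMod.card, smul_eq_mul, mul_comm p n] at h2
  omega

theorem prod_mul_prod_filter_card_fibre
    (ha : ∀ c, #{u ∈ U | a u = c} = n ∨ #{u ∈ U | a u = c} + 1 = n) :
    (∏ u ∈ U, (1 - C (a u) * X)) * ∏ c with #{u ∈ U | a u = c} + 1 = n, (1 - C c * X)
      = (1 - X ^ (p - 1) : (ZMod p)[X]) ^ n := by
  rw [← prod_one_sub_C_mul_X_zmod, ← Finset.prod_pow,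
    ← Finset.prod_fiberwise' U a (fun c => (1 - C c * X : (ZMod p)[X])), Finset.prod_filter,
    ← Finset.prod_mul_distrib]
  refine Finset.prod_congr rfl fun c _ => ?_
  rw [Finset.prod_const]
  rcases ha c with h | h
  · rw [if_neg (by omega), h, mul_one]
  · rw [if_pos h, ← pow_succ, h]

theorem coeff_invProdSeries_eq_coeff_prod
    (ha : ∀ c, #{u ∈ U | a u = c} = n ∨ #{u ∈ U | a u = c} + 1 = n) {j : ℕ} (hj : j < p - 1) :
    PowerSeries.coeff j (invProdSeries U a)
      = (∏ c with #{u ∈ U | a u = c} + 1 = n, (1 - C c * X) : (ZMod p)[X]).coeff j := by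
  set P : (ZMod p)[X] := ∏ u ∈ U, (1 - C (a u) * X) with hP
  set Q : (ZMod p)[X] := ∏ c with #{u ∈ U | a u = c} + 1 = n, (1 - C c * X) with hQ
  have h1 : P * Q = (1 - X ^ (p - 1)) ^ n := prod_mul_prod_filter_card_fibre ha
  have h2 : (P : PowerSeries (ZMod p)) * invProdSeries U a = 1 :=
    prod_one_sub_C_mul_X_mul_invProdSeries U a
  have h3 : (X ^ (p - 1) : (ZMod p)[X]) ∣ P * Q - 1 := by
    have := sub_dvd_pow_sub_pow (1 - X ^ (p - 1) : (ZMod p)[X]) 1 n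
    rw [one_pow, ← h1] at this
    refine dvd_trans ?_ this
    rw [sub_sub_cancel_left, dvd_neg]
  have h4 := _root_.map_dvd (coeToPowerSeries.ringHom (R := ZMod p)) h3
  simp only [coeToPowerSeries.ringHom_apply, Polynomial.coe_sub, Polynomial.coe_mul,
    Polynomial.coe_one, Polynomial.coe_pow, Polynomial.coe_X] at h4
  have h5 : PowerSeries.X ^ (p - 1) ∣ (Q : PowerSeries (ZMod p)) - invProdSeries U a := by
    have : (Q : PowerSeries (ZMod p)) - invProdSeries U a
        = invProdSeries U a * ((P : PowerSeries (ZMod p)) * Q - 1) := by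
      linear_combination (-(Q : PowerSeries (ZMod p))) * h2
    rw [this]
    exact h4.mul_left _
  have h6 := PowerSeries.X_pow_dvd_iff.mp h5 j hj
  rw [map_sub, sub_eq_zero, coeff_coe] at h6
  exact h6.symm

end Fibres

theorem prod_X_sub_C_dvd_X_pow_sub_X_mul_derivative {ι : Type*} {p : ℕ} [Fact p.Prime]
    (U : Finset ι) (a : ι → ZMod p) :
    ∏ u ∈ U, (X - C (a u)) ∣ (X ^ p - X) * derivative (∏ u ∈ U, (X - C (a u))) := by
  induction U using Finset.induction_on with
  | empty => simp
  | insert u s hu ih =>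
    have h1 : X - C (a u) ∣ (X ^ p - X : (ZMod p)[X]) := by
      rw [← prod_X_sub_C_zmod]
      exact Finset.dvd_prod_of_mem (fun c => X - C c) (Finset.mem_univ (a u))
    rw [Finset.prod_insert hu, derivative_mul, derivative_sub, derivative_X, derivative_C, sub_zero,
      one_mul, mul_add]
    refine dvd_add (mul_dvd_mul_right h1 _) ?_
    rw [mul_left_comm]
    exact mul_dvd_mul_left _ ih

/-- Let the functionals `α + y β`, for `y ∈ Y`, have all their fibres on `U` of size `n` or
`n - 1`. Then at most `n` fibres of `α` have more than `n` points. -/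
theorem card_filter_lt_card_fibre_le {ι : Type*} {p n r e : ℕ} [Fact p.Prime] {U : Finset ι}
    {α β : ι → ZMod p} (hcard : U.card + r = n * p) (hn : 1 ≤ n) (he : 1 ≤ e)
    (hner : (n + 1) * e + r ≤ p) (Y : Finset (ZMod p)) (hY : p ≤ Y.card + e)
    (hfib : ∀ y ∈ Y, ∀ c, #{u ∈ U | α u + y * β u = c} = n ∨ #{u ∈ U | α u + y * β u = c} + 1 = n) :
    #{c | n + 1 ≤ #{u ∈ U | α u = c}} ≤ n := by
  have hne : 2 * e ≤ (n + 1) * e := Nat.mul_le_mul_right e (by omega)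
  obtain ⟨Y', hY'Y, hY'⟩ := Finset.exists_subset_card_eq (s := Y) (n := p - e) (by omega)
  replace hfib := fun y hy => hfib y (hY'Y hy)
  clear hY hY'Y Y
  set S := invProdSeries U fun u => C (α u) + C (β u) * X with hS
  have hSdeg : ∀ j, (PowerSeries.coeff j S).natDegree ≤ j :=
    natDegree_coeff_invProdSeries_le U _ fun u _ => by compute_degree
  have hSmap : ∀ y, PowerSeries.map (evalRingHom y) S = invProdSeries U fun u => α u + y * β u := by
    intro y
    rw [hS, map_invProdSeries]
    congr 1
    funext u
    rw [coe_evalRingHom, eval_add, eval_mul, eval_C, eval_C, eval_X, mul_comm]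
  have hSeval : ∀ y ∈ Y', ∀ j < p - 1, (PowerSeries.coeff j S).eval y
      = (∏ c with #{u ∈ U | α u + y * β u = c} + 1 = n, (1 - C c * X) : (ZMod p)[X]).coeff j := by
    intro y hy j hj
    rw [← coeff_invProdSeries_eq_coeff_prod (hfib y hy) hj, ← hSmap, PowerSeries.coeff_map,
      coe_evalRingHom]
  have hEcard : ∀ y ∈ Y', #{c | #{u ∈ U | α u + y * β u = c} + 1 = n} = r := fun y hy =>
    card_filter_card_fibre_add_one_eq hcard (hfib y hy)
  have hSzero : ∀ j, r < j → j < p - e → PowerSeries.coeff j S = 0 := by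
    intro j hj1 hj2
    refine eq_zero_of_natDegree_lt_card_of_eval_eq_zero' _ Y' (fun y hy => ?_)
      (lt_of_le_of_lt (hSdeg j) (by omega))
    rw [hSeval y hy j (by omega)]
    refine coeff_eq_zero_of_natDegree_lt (lt_of_le_of_lt
      (natDegree_prod_one_sub_C_mul_X_le _ _) ?_)
    rwa [hEcard y hy]
  set G : (ZMod p)[X][X] := reflect r (PowerSeries.trunc (r + 1) S) with hG
  have hGcoeff : ∀ i, G.coeff i = if i ≤ r then PowerSeries.coeff (r - i) S else 0 := by
    intro i
    rw [hG, coeff_reflect, PowerSeries.coeff_trunc]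
    split_ifs with h1 h2 h2
    · rw [revAt_le h2]
    · rw [revAt_eq_self_of_lt (not_le.mp h2)] at h1; omega
    · rw [revAt_le h2] at h1; omega
    · rfl
  have hGle : G.natDegree ≤ r := natDegree_le_iff_coeff_eq_zero.mpr fun i hi => by
    rw [hGcoeff, if_neg (by omega)]
  have hGr : G.coeff r = 1 := by
    rw [hGcoeff, if_pos le_rfl, Nat.sub_self, hS, constantCoeff_invProdSeries]
  have hGm : G.Monic := monic_of_natDegree_le_of_coeff_eq_one r hGle hGr
  have hGdeg : G.natDegree = r :=
    natDegree_eq_of_le_of_coeff_ne_zero hGle (by rw [hGr]; exact one_ne_zero)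
  have hGtot : HasTotalDegreeLE G r := by
    intro i j hij
    rw [hGcoeff]
    split_ifs with h
    · exact coeff_eq_zero_of_natDegree_lt (lt_of_le_of_lt (hSdeg _) (by omega))
    · rw [coeff_zero]
  have hGdvd : ∀ y ∈ Y', G.map (evalRingHom y) ∣ X ^ p - X := by
    intro y hy
    have h1 : G.map (evalRingHom y)
        = ∏ c with #{u ∈ U | α u + y * β u = c} + 1 = n, (X - C c) := by
      have h2 := reflect_prod_one_sub_C_mul_X
        ({c | #{u ∈ U | α u + y * β u = c} + 1 = n} : Finset (ZMod p)) id
      have h3 := natDegree_prod_one_sub_C_mul_X_le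
        ({c | #{u ∈ U | α u + y * β u = c} + 1 = n} : Finset (ZMod p)) id
      rw [hEcard y hy] at h2 h3
      simp only [id] at h2 h3
      rw [← h2]
      ext1 i
      rw [coeff_map, hGcoeff, coeff_reflect]
      split_ifs with h
      · rw [revAt_le h, coe_evalRingHom, hSeval y hy _ (by omega)]
      · rw [map_zero, revAt_eq_self_of_lt (not_le.mp h), coeff_eq_zero_of_natDegree_lt
          (lt_of_le_of_lt h3 (by omega))]
    rw [h1, ← prod_X_sub_C_zmod]
    exact Finset.prod_dvd_prod_of_subset _ _ _ (Finset.subset_univ _)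
  have hG0 := map_evalRingHom_dvd_X_pow_sub_X_mul_derivative (e := e) hGm hGdeg hGtot Y'
    (by omega) (by omega) hGdvd 0
  set G₀ := G.map (evalRingHom 0) with hG₀
  set H : (ZMod p)[X] := ∏ u ∈ U, (X - C (α u)) with hH
  have hHm : H.Monic := monic_prod_of_monic _ _ fun u _ => monic_X_sub_C _
  have hHdeg : H.natDegree = U.card := natDegree_finsetProd_X_sub_C_eq_card _ _
  have hG₀m : G₀.Monic := hGm.map _
  have hFm : (H * G₀).Monic := hHm.mul hG₀m
  have hFdeg : (H * G₀).natDegree = p * n := by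
    rw [hHm.natDegree_mul hG₀m, hHdeg, hG₀, hGm.natDegree_map, hGdeg, hcard, mul_comm]
  have hgap : ∀ k, p * n + e < k + p → k ≠ p * n → (H * G₀).coeff k = 0 := by
    intro k hk hkn
    rcases lt_or_gt_of_ne hkn with hlt | hlt
    swap
    · exact coeff_eq_zero_of_natDegree_lt (by omega)
    set P : (ZMod p)[X] := ∏ u ∈ U, (1 - C (α u) * X) with hP
    have hPdeg : P.natDegree ≤ U.card := natDegree_prod_one_sub_C_mul_X_le _ _
    set T : (ZMod p)[X] := PowerSeries.trunc (r + 1) (invProdSeries U α) with hT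
    have hTdeg : T.natDegree ≤ r := Nat.lt_succ_iff.mp (PowerSeries.natDegree_trunc_lt _ _)
    have hα : PowerSeries.map (evalRingHom 0) S = invProdSeries U α := by
      rw [hSmap]; simp
    have hG₀T : G₀ = reflect r T := by
      ext1 i
      rw [hG₀, coeff_map, hGcoeff, coeff_reflect, hT, PowerSeries.coeff_trunc, ← hα]
      split_ifs with h1 h2 h2
      · rw [revAt_le h1, PowerSeries.coeff_map]
      · rw [revAt_le h1] at h2; omega
      · rw [revAt_eq_self_of_lt (not_le.mp h1)] at h2; omega
      · exact map_zero _
    rw [hG₀T, hH, ← reflect_prod_one_sub_C_mul_X, ← reflect_mul _ _ hPdeg hTdeg, coeff_reflect,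
      hcard, mul_comm n p, revAt_le hlt.le]
    have h1 : PowerSeries.X ^ (p - e) ∣ (T : PowerSeries (ZMod p)) - invProdSeries U α := by
      rw [PowerSeries.X_pow_dvd_iff]
      intro j hj
      rw [map_sub, coeff_coe, hT, PowerSeries.coeff_trunc]
      split_ifs with h
      · rw [sub_self]
      · rw [← hα, PowerSeries.coeff_map, hSzero j (by omega) hj, map_zero, sub_zero]
    have h2 : (P : PowerSeries (ZMod p)) * invProdSeries U α = 1 :=
      prod_one_sub_C_mul_X_mul_invProdSeries U α
    have h3 := PowerSeries.X_pow_dvd_iff.mp (h1.mul_left (P : PowerSeries (ZMod p)))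
      (p * n - k) (by omega)
    rw [mul_sub, h2, map_sub, PowerSeries.coeff_one, if_neg (by omega), sub_zero,
      ← Polynomial.coe_mul, coeff_coe] at h3
    exact h3
  obtain ⟨ψ, hψ⟩ : H * G₀ ∣ (X ^ p - X) * derivative (H * G₀) := by
    rw [derivative_mul, mul_add]
    refine dvd_add ?_ ?_
    · rw [← mul_assoc]
      exact mul_dvd_mul_right (prod_X_sub_C_dvd_X_pow_sub_X_mul_derivative U α) _
    · rw [mul_left_comm]
      exact mul_dvd_mul_left _ hG0
  rw [mul_comm _ ψ] at hψ
  have hψ0 := natDegree_eq_zero_of_X_pow_sub_X_mul_derivative hn he (by omega) hFm hFdeg hgap hψ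
  rw [eq_C_of_natDegree_eq_zero hψ0] at hψ
  refine card_le_of_lt_rootMultiplicity hFm hFdeg hψ _ fun c hc => ?_
  rw [Finset.mem_filter_univ] at hc
  refine hc.trans ((le_rootMultiplicity_iff hFm.ne_zero).mpr (Dvd.dvd.mul_right ?_ _))
  have h1 : (X - C c) ^ #{u ∈ U | α u = c} = ∏ u ∈ U with α u = c, (X - C (α u)) := by
    rw [← Finset.prod_const]
    exact Finset.prod_congr rfl fun u hu => by rw [(Finset.mem_filter.mp hu).2]
  rw [h1]
  exact Finset.prod_dvd_prod_of_subset _ _ _ (Finset.filter_subset _ _)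

/-- The linear functional on the plane whose fibres are the lines of slope `m`. -/
def slopeCoord {p : ℕ} (m : Option (ZMod p)) (u : ZMod p × ZMod p) : ZMod p :=
  match m with
  | some m => u.2 - m * u.1
  | none => u.1

section Slopes

variable {p : ℕ} [Fact p.Prime]

theorem mem_lineWithSlope {m : Option (ZMod p)} {c : ZMod p} {u : ZMod p × ZMod p} :
    u ∈ lineWithSlope p m c ↔ slopeCoord m u = c := by
  cases m with
  | none => simp [lineWithSlope, slopeCoord]
  | some m => simp [lineWithSlope, slopeCoord, sub_eq_iff_eq_add, add_comm]

theorem card_lineWithSlope_inter (U : Finset (ZMod p × ZMod p)) (m : Option (ZMod p))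
    (c : ZMod p) : (lineWithSlope p m c ∩ U).card = #{u ∈ U | slopeCoord m u = c} := by
  congr 1
  ext u
  rw [Finset.mem_inter, mem_lineWithSlope, Finset.mem_filter, and_comm]

theorem eq_of_slopeCoord_eq_mul {m m' : Option (ZMod p)} {k : ZMod p}
    (h : ∀ u, slopeCoord m u = k * slopeCoord m' u) : m = m' := by
  have h1 := h (0, 1)
  have h2 := h (1, 0)
  cases m <;> cases m' <;> simp [slopeCoord] at h1 h2 ⊢
  · simp [← h1] at h2
  · simpa [← h1] using h2

theorem exists_slopeCoord_add_mul_slopeCoord_eq (m m' : Option (ZMod p)) (y : ZMod p) :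
    ∃ m'' k, ∀ u, slopeCoord m u + y * slopeCoord m' u = k * slopeCoord m'' u := by
  have hlin : ∀ m : Option (ZMod p), ∃ A B, ∀ u, slopeCoord m u = A * u.1 + B * u.2 := by
    rintro (_ | m)
    · exact ⟨1, 0, fun u => by simp [slopeCoord]⟩
    · exact ⟨-m, 1, fun u => by simp only [slopeCoord]; ring⟩
  obtain ⟨A, B, h⟩ := hlin m
  obtain ⟨A', B', h'⟩ := hlin m'
  by_cases hB : B + y * B' = 0
  · refine ⟨none, A + y * A', fun u => ?_⟩
    rw [h, h']
    simp only [slopeCoord]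
    linear_combination u.2 * hB
  · refine ⟨some (-(A + y * A') / (B + y * B')), B + y * B', fun u => ?_⟩
    rw [h, h']
    simp only [slopeCoord]
    field_simp
    ring

theorem exists_slopeCoord_eq_of_ne (u v : ZMod p × ZMod p) :
    ∃ m, slopeCoord m v = slopeCoord m u := by
  by_cases h : v.1 = u.1
  · exact ⟨none, h⟩
  · refine ⟨some ((v.2 - u.2) / (v.1 - u.1)), ?_⟩
    have h' : v.1 - u.1 ≠ 0 := sub_ne_zero.mpr h
    simp only [slopeCoord]
    field_simp
    ring

end Slopes

section RichLines

variable {p n r : ℕ} [Fact p.Prime] {U : Finset (ZMod p × ZMod p)}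

theorem isRich_lineWithSlope_iff (hrp : r < p) (hcard : U.card + r = n * p)
    (m : Option (ZMod p)) (c : ZMod p) :
    IsRich p U (lineWithSlope p m c) ↔ n + 1 ≤ #{u ∈ U | slopeCoord m u = c} := by
  have hp : (0 : ℚ) < p := by exact_mod_cast (Fact.out : p.Prime).pos
  rw [IsRich, card_lineWithSlope_inter, ← le_sub_iff_add_le, div_le_iff₀ hp]
  generalize #{u ∈ U | slopeCoord m u = c} = k
  have hc : (U.card : ℚ) = n * p - r := by
    rw [eq_sub_iff_add_eq]; exact_mod_cast hcard
  have hr : (r : ℚ) < p := by exact_mod_cast hrp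
  rw [hc]
  constructor
  · intro h
    by_contra! hk
    have : (k : ℚ) ≤ n := by exact_mod_cast (by omega : k ≤ n)
    nlinarith
  · intro h
    have : (n : ℚ) + 1 ≤ k := by exact_mod_cast h
    have : (0 : ℚ) ≤ r := by positivity
    nlinarith

theorem card_fibre_of_not_isSpecialDir (hrp : r < p) (hcard : U.card + r = n * p)
    {m : Option (ZMod p)} (hm : ¬ IsSpecialDir p U m) (c : ZMod p) :
    #{u ∈ U | slopeCoord m u = c} = n ∨ #{u ∈ U | slopeCoord m u = c} + 1 = n := by
  have h : ¬ (IsRich p U (lineWithSlope p m c) ∨ IsPoor p U (lineWithSlope p m c)) :=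
    fun h => hm ⟨c, h⟩
  rw [not_or, isRich_lineWithSlope_iff hrp hcard, IsPoor, card_lineWithSlope_inter] at h
  obtain ⟨h1, h2⟩ := h
  have hp : (0 : ℚ) < p := by exact_mod_cast (Fact.out : p.Prime).pos
  rw [le_sub_iff_add_le, le_div_iff₀ hp] at h2
  generalize #{u ∈ U | slopeCoord m u = c} = k at *
  by_contra! hk
  have hk2 : k + 2 ≤ n := by omega
  refine h2 ?_
  have hc : (U.card : ℚ) = n * p - r := by
    rw [eq_sub_iff_add_eq]; exact_mod_cast hcard
  have hr : (r : ℚ) < p := by exact_mod_cast hrp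
  have hk3 : (k : ℚ) + 2 ≤ n := by exact_mod_cast hk2
  rw [hc]
  nlinarith

theorem wSlope_le (hn : 1 ≤ n) (hr : r + n < p) (hcard : U.card + r = n * p)
    (hD : #{m | IsSpecialDir p U m} * (n + 1) + r ≤ n + 1 + p) (m : Option (ZMod p)) :
    wSlope p U m ≤ n := by
  set Sp : Finset (Option (ZMod p)) := {m | IsSpecialDir p U m} with hSp
  have hw : wSlope p U m = #{c | n + 1 ≤ #{u ∈ U | slopeCoord m u = c}} := by
    rw [wSlope]
    congr 1
    ext c
    rw [Finset.mem_filter_univ, Finset.mem_filter_univ,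
      isRich_lineWithSlope_iff (by omega) hcard]
  rw [hw]
  obtain ⟨m', hm', e, he, hner, hcount⟩ : ∃ m', m' ≠ m ∧ ∃ e, 1 ≤ e ∧ (n + 1) * e + r ≤ p ∧
      (Sp.erase m').card ≤ e := by
    rcases le_or_gt Sp.card 1 with h | h
    · obtain ⟨m', hm'⟩ := exists_ne m
      exact ⟨m', hm', 1, le_rfl, by omega, Finset.card_erase_le.trans h⟩
    · obtain ⟨m', hm'S, hm'⟩ := Finset.exists_mem_ne h m
      refine ⟨m', hm', Sp.card - 1, by omega, ?_, (Finset.card_erase_of_mem hm'S).le⟩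
      obtain ⟨d, hd⟩ : ∃ d, Sp.card = d + 1 := ⟨Sp.card - 1, by omega⟩
      rw [hd] at hD ⊢
      rw [Nat.add_sub_cancel]
      linarith
  choose g k hgk using exists_slopeCoord_add_mul_slopeCoord_eq m m'
  have hk : ∀ y, k y ≠ 0 := by
    intro y hy
    refine hm' (eq_of_slopeCoord_eq_mul (k := -y) fun u => ?_).symm
    have := hgk y u
    rw [hy] at this
    linear_combination this
  have hgm' : ∀ y, g y ≠ m' := by
    intro y hy
    refine hm' (eq_of_slopeCoord_eq_mul (k := k y - y) fun u => ?_).symm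
    have := hgk y u
    rw [hy] at this
    linear_combination this
  have hginj : Function.Injective g := by
    intro y y' hyy'
    by_contra hne
    have hne' : y - y' ≠ 0 := sub_ne_zero.mpr hne
    refine hgm' y (eq_of_slopeCoord_eq_mul (k := (k y - k y') / (y - y')) fun u => ?_).symm
    have h1 := hgk y u
    have h2 := hgk y' u
    rw [← hyy'] at h2
    field_simp
    linear_combination h1 - h2
  refine card_filter_lt_card_fibre_le (β := slopeCoord m') hcard hn he hner
    ({y | ¬ IsSpecialDir p U (g y)} : Finset (ZMod p)) ?_ fun y hy c => ?_
  · have h1 := Finset.card_filter_add_card_filter_not (s := (Finset.univ : Finset (ZMod p)))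
      fun y => IsSpecialDir p U (g y)
    have h2 : #{y | IsSpecialDir p U (g y)} ≤ (Sp.erase m').card := by
      refine Finset.card_le_card_of_injOn g (fun y hy => ?_) hginj.injOn
      rw [Finset.mem_coe, Finset.mem_filter_univ] at hy
      rw [Finset.mem_coe, Finset.mem_erase, hSp, Finset.mem_filter_univ]
      exact ⟨hgm' y, hy⟩
    rw [Finset.card_univ, ZMod.card] at h1
    omega
  · rw [Finset.mem_filter_univ] at hy
    have h1 : ∀ u, slopeCoord m u + y * slopeCoord m' u = c
        ↔ slopeCoord (g y) u = (k y)⁻¹ * c := by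
      intro u
      rw [hgk, eq_inv_mul_iff_mul_eq₀ (hk y)]
    simp only [h1]
    exact card_fibre_of_not_isSpecialDir (by omega) hcard hy _

theorem card_richLines_le (hn : 1 ≤ n) (hr : r + n < p) (hcard : U.card + r = n * p)
    (hD : #{m | IsSpecialDir p U m} * (n + 1) + r ≤ n + 1 + p) :
    (richLines p U).card ≤ n * #{m | IsSpecialDir p U m} := by
  refine Finset.card_le_mul_card_image_of_maps_to (f := Prod.fst) (fun q hq => ?_) n fun m _ => ?_
  · rw [richLines, Finset.mem_filter_univ] at hq
    rw [Finset.mem_filter_univ]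
    exact ⟨q.2, Or.inl hq⟩
  · refine le_trans ?_ (wSlope_le hn hr hcard hD m)
    refine Finset.card_le_card_of_injOn Prod.snd (fun q hq => ?_) fun q hq q' hq' h => ?_
    · rw [Finset.mem_coe, Finset.mem_filter, richLines, Finset.mem_filter_univ] at hq
      rw [Finset.mem_coe, Finset.mem_filter_univ, ← hq.2]
      exact hq.1
    · rw [Finset.mem_coe, Finset.mem_filter] at hq hq'
      exact Prod.ext (hq.2.trans hq'.2.symm) h

theorem exists_mem_richLines_of_mem (hn : 1 ≤ n) (hr : r + n < p) (hcard : U.card + r = n * p)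
    {u : ZMod p × ZMod p} (hu : u ∈ U) :
    ∃ q ∈ richLines p U, u ∈ lineWithSlope p q.1 q.2 := by
  suffices h : ∃ m, n + 1 ≤ #{v ∈ U | slopeCoord m v = slopeCoord m u} by
    obtain ⟨m, hm⟩ := h
    refine ⟨(m, slopeCoord m u), ?_, mem_lineWithSlope.mpr rfl⟩
    rw [richLines, Finset.mem_filter_univ, isRich_lineWithSlope_iff (by omega) hcard]
    exact hm
  by_contra! h
  have h1 : U.erase u ⊆ (Finset.univ : Finset (Option (ZMod p))).biUnion fun m =>
      {v ∈ U.erase u | slopeCoord m v = slopeCoord m u} := by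
    intro v hv
    obtain ⟨m, hm⟩ := exists_slopeCoord_eq_of_ne u v
    exact Finset.mem_biUnion.mpr ⟨m, Finset.mem_univ _, Finset.mem_filter.mpr ⟨hv, hm⟩⟩
  have h2 := (Finset.card_le_card h1).trans <|
    Finset.card_biUnion_le_card_mul _ _ (n - 1) fun m _ => by
      have hum : u ∈ {v ∈ U | slopeCoord m v = slopeCoord m u} := Finset.mem_filter.mpr ⟨hu, rfl⟩
      rw [Finset.filter_erase, Finset.card_erase_of_mem hum]
      have := h m
      omega
  rw [Finset.card_erase_of_mem hu, Finset.card_univ, Fintype.card_option, ZMod.card] at h2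
  obtain ⟨n, rfl⟩ : ∃ n', n = n' + 1 := ⟨n - 1, by omega⟩
  rw [Nat.add_sub_cancel, add_mul, one_mul, mul_comm] at h2
  rw [add_mul, one_mul] at hcard
  omega

theorem lt_card_richLines (hn : 1 ≤ n) (hr : r + n < p) (hcard : U.card + r = n * p)
    (hlines : ¬ ∃ L : Fin n → Option (ZMod p) × ZMod p,
      ∀ u ∈ U, ∃ i : Fin n, u ∈ lineWithSlope p (L i).1 (L i).2) :
    n < (richLines p U).card := by
  by_contra! h
  let e := (richLines p U).equivFin
  refine hlines ⟨fun i => if hi : i < (richLines p U).card then (e.symm ⟨i, hi⟩).1 else (none, 0),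
    fun u hu => ?_⟩
  obtain ⟨q, hq, huq⟩ := exists_mem_richLines_of_mem hn hr hcard hu
  refine ⟨⟨e ⟨q, hq⟩, (e ⟨q, hq⟩).2.trans_le h⟩, ?_⟩
  simpa using huq

end RichLines

theorem mul_add_two_le_of_mul_le {n p s w : ℚ} (hn : 1 ≤ n) (hsn : n + 1 ≤ s) (hsp : s ≤ p)
    (hw : w * (n + 1) ≤ n * (n + 1 + s)) :
    (p + s - 1) * (w + 2) ≤ 2 * (p * s + n * p - p + s) := by
  have h1 : (p + s - 1) * (w * (n + 1)) ≤ (p + s - 1) * (n * (n + 1 + s)) :=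
    mul_le_mul_of_nonneg_left hw (by linarith)
  have h2 : 0 ≤ (p - s) * (s * (n + 2) + (n + 1) * (n - 4)) :=
    mul_nonneg (by linarith) (by nlinarith)
  have h3 : 0 ≤ (s - (n + 1)) * (2 * s - (n + 2)) := mul_nonneg (by linarith) (by linarith)
  refine le_of_mul_le_mul_right ?_ (by linarith : 0 < n + 1)
  linarith

theorem f_max_at_n_add_one (p n r : ℕ) [Fact p.Prime]
    (U : Finset (ZMod p × ZMod p))
    (hn : 1 ≤ n) (hnp : n < p) (hr : r + n < p)
    (hcard : (U.card : ℤ) = n * p - r)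
    (hlines : ¬ ∃ L : Fin n → Option (ZMod p) × ZMod p,
      ∀ u ∈ U, ∃ i : Fin n, u ∈ lineWithSlope p (L i).1 (L i).2)
    (hD : (({m : Option (ZMod p) | IsSpecialDir p U m}.ncard : ℚ))
        ≤ 1 + ((p : ℚ) - r) / (n + 1))
    (f : ℚ → ℚ)
    (hf : ∀ T : ℚ, f T = ((p : ℚ) - r / 2 - 1 / 2) * T ^ 2
        - ((n : ℚ) - 1) * ((p : ℚ) - r / 2 - 1 / 2) * T
        - (p : ℚ) * ((p : ℚ) - r) * T - (U.card : ℚ) * T) :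
    f (((richLines p U).card : ℚ)) ≤ f ((n : ℚ) + 1) := by
  have hN : U.card + r = n * p := by zify; linarith
  have hNQ : (U.card : ℚ) = n * p - r := by exact_mod_cast hcard
  have hS : {m : Option (ZMod p) | IsSpecialDir p U m}.ncard = #{m | IsSpecialDir p U m} := by
    rw [← Set.ncard_coe_finset, Finset.coe_filter_univ]
  rw [hS] at hD
  have hn0 : (0 : ℚ) < n + 1 := by positivity
  have hDmul : (#{m | IsSpecialDir p U m} : ℚ) * (n + 1) ≤ n + 1 + (p - r) := by
    have := mul_le_mul_of_nonneg_right hD hn0.le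
    rwa [add_mul, one_mul, div_mul_cancel₀ _ hn0.ne'] at this
  have hDnat : #{m | IsSpecialDir p U m} * (n + 1) + r ≤ n + 1 + p := by
    have : (#{m | IsSpecialDir p U m} : ℚ) * (n + 1) + r ≤ n + 1 + p := by linarith
    exact_mod_cast this
  have hlow : (n : ℚ) + 1 ≤ (richLines p U).card := by
    exact_mod_cast lt_card_richLines hn hr hN hlines
  have hup : ((richLines p U).card : ℚ) ≤ n * #{m | IsSpecialDir p U m} := by
    exact_mod_cast card_richLines_le hn hr hN hDnat
  generalize ((richLines p U).card : ℚ) = w at *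
  have hn1 : (1 : ℚ) ≤ n := by exact_mod_cast hn
  have hr0 : (0 : ℚ) ≤ r := by positivity
  have hrQ : (r : ℚ) + n + 1 ≤ p := by exact_mod_cast hr
  have hw : w * (n + 1) ≤ n * (n + 1 + (p - r)) := by nlinarith
  have key := mul_add_two_le_of_mul_le (n := n) (p := p) (s := (p : ℚ) - r) (w := w) hn1
    (by linarith) (by linarith) hw
  rw [hf, hf, hNQ, ← sub_nonneg]
  have := mul_nonneg (sub_nonneg.mpr hlow) (sub_nonneg.mpr key)
  linarith
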